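/- Convergence in cost of the distributed min-max algorithm (Theorem 1, part 1): suppose γ satisfies the diminishing condition, the set of minimizers of η is nonempty, and sequences λ^{ij}(t) ∈ ℝ^S for (i,j) ∈ E, μ^i(t) ∈ ℝ^S and ρ^i(t) ∈ ℝ for i ∈ {1,…,N} satisfy for all t ∈ ℕ: (i) for each i, μ^i(t+1) maximizes μ ↦ q^i(μ) + μᵀ Σ_{j∈N_i}(λ^{ij}(t) − λ^{ji}(t)) over Δ; (ii) for each i, ρ^i(t+1) = inf_{x ∈ X^i} max_{s ∈ {1,…,S}} ( g^i_s(x_s) + ( Σ_{j∈N_i}(λ^{ij}(t) − λ^{ji}(t)) )_s ); (iii) for each (i,j) ∈ E, λ^{ij}(t+1) = λ^{ij}(t) − γ(t)(μ^i(t+1) − μ^j(t+1)). Then Σ_{i=1}^N ρ^i(t) converges to P* as t → ∞. -/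

import Mathlib

open Finset Filter Topology

noncomputable section

/-- The unit simplex in `ℝ^S`. -/
def unitSimplex (S : ℕ) : Set (Fin S → ℝ) :=
  {μ | (∀ s, 0 ≤ μ s) ∧ ∑ s, μ s = 1}

/-- The local dual function `q^i(μ) = inf_{x ∈ X^i} Σ_s μ_s g^i_s(x_s)`. -/
def dualFn {N S : ℕ} (X : Fin N → Set (Fin S → ℝ))
    (g : Fin N → Fin S → ℝ → ℝ) (i : Fin N) (μ : Fin S → ℝ) : ℝ :=
  sInf ((fun x : Fin S → ℝ => ∑ s, μ s * g i s (x s)) '' X i)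

/-- The set of achievable primal (min-max) values. -/
def primalSet {N S : ℕ} (X : Fin N → Set (Fin S → ℝ))
    (g : Fin N → Fin S → ℝ → ℝ) : Set ℝ :=
  {P | ∃ x : Fin N → Fin S → ℝ, (∀ i, x i ∈ X i) ∧
    P = ⨆ s : Fin S, ∑ i, g i s (x i s)}

/-- `Σ_{j ∈ N_i} (λ^{ij} − λ^{ji})`. -/
def edgeDiff {N S : ℕ} (G : SimpleGraph (Fin N)) [DecidableRel G.Adj]
    (lam : Fin N → Fin N → Fin S → ℝ) (i : Fin N) : Fin S → ℝ :=
  ∑ j ∈ Finset.univ.filter (fun j => G.Adj i j), (lam i j - lam j i)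

/-- The dual-of-dual objective `η({λ^{ij}}) = Σ_i η^i`. -/
def etaFn {N S : ℕ} (X : Fin N → Set (Fin S → ℝ))
    (g : Fin N → Fin S → ℝ → ℝ) (G : SimpleGraph (Fin N)) [DecidableRel G.Adj]
    (lam : Fin N → Fin N → Fin S → ℝ) : ℝ :=
  ∑ i, sSup {v | ∃ μ ∈ unitSimplex S,
    v = dualFn X g i μ + ∑ s, μ s * edgeDiff G lam i s}

/-! ### Scalar recursions -/

/-- A sequence bounded below whose increments are bounded above by a summable sequence converges. -/
theorem exists_tendsto_of_le_add_summable {b e : ℕ → ℝ} (hb : ∀ t, 0 ≤ b t) (he : Summable e)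
    (h : ∀ t, b (t + 1) ≤ b t + e t) : ∃ l, Tendsto b atTop (𝓝 l) := by
  set c : ℕ → ℝ := fun n => b n - ∑ t ∈ range n, e t with hc
  have hanti : Antitone c := antitone_nat_of_succ_le fun n => by
    simp only [hc, sum_range_succ]
    linarith [h n]
  have hE := he.hasSum.tendsto_sum_nat
  obtain ⟨B, hB⟩ := hE.bddAbove_range
  have hbdd : BddBelow (Set.range c) := by
    refine ⟨-B, ?_⟩
    rintro _ ⟨n, rfl⟩
    have := hB ⟨n, rfl⟩
    simp only [hc] at this ⊢
    linarith [hb n]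
  refine ⟨_, ((tendsto_atTop_ciInf hanti hbdd).add hE).congr fun n => ?_⟩
  simp [hc]

/-- If `γ` is square-summable with divergent sum, `γ * a` is summable, `a ≥ 0` and the increments
of `a` are at most `K * γ`, then `a` tends to zero. -/
theorem tendsto_zero_of_summable_mul {γ a : ℕ → ℝ} {K : ℝ} (hγ : ∀ t, 0 ≤ γ t)
    (hdiv : Tendsto (fun n => ∑ t ∈ range n, γ t) atTop atTop)
    (hsq : Summable fun t => γ t ^ 2) (ha : ∀ t, 0 ≤ a t) (hγa : Summable fun t => γ t * a t)
    (hinc : ∀ t, a (t + 1) ≤ a t + K * γ t) : Tendsto a atTop (𝓝 0) := by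
  obtain ⟨l, hl⟩ := exists_tendsto_of_le_add_summable (b := fun t => a t ^ 2)
    (e := fun t => 2 * K * (γ t * a t) + K ^ 2 * γ t ^ 2) (fun t => sq_nonneg _)
    ((hγa.mul_left _).add (hsq.mul_left _)) fun t => by
      have := pow_le_pow_left₀ (ha (t + 1)) (hinc t) 2
      nlinarith [this]
  have hlim : Tendsto a atTop (𝓝 √l) :=
    ((Real.continuous_sqrt.tendsto l).comp hl).congr fun t => Real.sqrt_sq (ha t)
  rcases (Real.sqrt_nonneg l).eq_or_lt with h0 | hpos
  · rwa [← h0] at hlim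
  exfalso
  have hev : ∀ᶠ t in atTop, ‖γ t‖ ≤ (√l / 2)⁻¹ * (γ t * a t) := by
    filter_upwards [hlim.eventually (lt_mem_nhds (half_lt_self hpos))] with t ht
    rw [Real.norm_of_nonneg (hγ t), inv_mul_eq_div, le_div_iff₀ (half_pos hpos)]
    exact mul_le_mul_of_nonneg_left ht.le (hγ t)
  have hs : Summable γ := summable_of_isBigO_nat hγa
    (Asymptotics.IsBigO.of_bound (√l / 2)⁻¹ (by
      filter_upwards [hev] with t ht
      rwa [Real.norm_of_nonneg (mul_nonneg (hγ t) (ha t))]))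
  exact not_tendsto_atTop_of_tendsto_nhds hs.hasSum.tendsto_sum_nat hdiv

/-! ### Edge differences -/

section EdgeDiff

variable {N S : ℕ} (G : SimpleGraph (Fin N)) [DecidableRel G.Adj]

theorem edgeDiff_apply (lam : Fin N → Fin N → Fin S → ℝ) (i : Fin N) (s : Fin S) :
    edgeDiff G lam i s = ∑ j, if G.Adj i j then lam i j s - lam j i s else 0 := by
  rw [edgeDiff, Finset.sum_apply, sum_filter]
  rfl

/-- Summation by parts on the graph. -/
theorem sum_mul_edgeDiff (m : Fin N → Fin S → ℝ) (lam : Fin N → Fin N → Fin S → ℝ) :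
    ∑ i, ∑ s, m i s * edgeDiff G lam i s =
      ∑ i, ∑ j, if G.Adj i j then ∑ s, (m i s - m j s) * lam i j s else 0 := by
  have h1 : ∑ i, ∑ s, m i s * edgeDiff G lam i s =
      (∑ i, ∑ j, if G.Adj i j then ∑ s, m i s * lam i j s else 0) -
        ∑ i, ∑ j, if G.Adj i j then ∑ s, m i s * lam j i s else 0 := by
    simp only [edgeDiff_apply, mul_sum, ← sum_sub_distrib]
    refine sum_congr rfl fun i _ => ?_
    rw [sum_comm]
    refine sum_congr rfl fun j _ => ?_
    split_ifs
    · rw [← sum_sub_distrib]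
      exact sum_congr rfl fun s _ => by ring
    · simp
  have h2 : (∑ i, ∑ j, if G.Adj i j then ∑ s, m i s * lam j i s else 0) =
      ∑ i, ∑ j, if G.Adj i j then ∑ s, m j s * lam i j s else 0 := by
    rw [sum_comm]
    simp only [G.adj_comm]
  rw [h1, h2]
  simp only [← sum_sub_distrib]
  refine sum_congr rfl fun i _ => sum_congr rfl fun j _ => ?_
  split_ifs
  · rw [← sum_sub_distrib]
    exact sum_congr rfl fun s _ => by ring
  · simp

theorem sum_edgeDiff (lam : Fin N → Fin N → Fin S → ℝ) (s : Fin S) :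
    ∑ i, edgeDiff G lam i s = 0 := by
  have h := sum_mul_edgeDiff G (fun _ s' => if s' = s then 1 else 0) lam
  simpa using h

theorem sum_mul_edgeDiff_sub (m : Fin N → Fin S → ℝ) (lam lam' : Fin N → Fin N → Fin S → ℝ) :
    ∑ i, ∑ s, m i s * edgeDiff G lam i s - ∑ i, ∑ s, m i s * edgeDiff G lam' i s =
      ∑ i, ∑ j, if G.Adj i j then ∑ s, (m i s - m j s) * (lam i j s - lam' i j s) else 0 := by
  simp only [sum_mul_edgeDiff, ← sum_sub_distrib]
  refine sum_congr rfl fun i _ => sum_congr rfl fun j _ => ?_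
  split_ifs
  · rw [← sum_sub_distrib]
    exact sum_congr rfl fun s _ => by ring
  · simp

/-- `edgeDiff` as a linear map. -/
def edgeDiffLin : (Fin N → Fin N → Fin S → ℝ) →ₗ[ℝ] (Fin N → Fin S → ℝ) where
  toFun := edgeDiff G
  map_add' l l' := by
    ext i s
    simp only [edgeDiff_apply, Pi.add_apply, ← sum_add_distrib]
    exact sum_congr rfl fun j _ => by split_ifs <;> ring
  map_smul' c l := by
    ext i s
    simp only [edgeDiff_apply, Pi.smul_apply, smul_eq_mul, mul_sum, RingHom.id_apply]
    exact sum_congr rfl fun j _ => by split_ifs <;> ring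

theorem single_sub_single_mem_range_of_adj {a b : Fin N} (hab : G.Adj a b) (v : Fin S → ℝ) :
    Pi.single a v - Pi.single b v ∈ LinearMap.range (edgeDiffLin (S := S) G) := by
  refine ⟨Pi.single a (Pi.single b v), ?_⟩
  ext i s
  change edgeDiff G _ i s = _
  rw [edgeDiff_apply]
  have hterm : ∀ j, (if G.Adj i j then
      (Pi.single a (Pi.single b v) : Fin N → Fin N → Fin S → ℝ) i j s -
        (Pi.single a (Pi.single b v) : Fin N → Fin N → Fin S → ℝ) j i s else 0) =
      (if j = b then (if i = a then v s else 0) else 0) -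
        if j = a then (if i = b then v s else 0) else 0 := by
    intro j
    simp only [Pi.single_apply]
    have hba := hab.symm
    split_ifs <;> simp_all
  rw [sum_congr rfl fun j _ => hterm j]
  simp only [sum_sub_distrib, sum_ite_eq', mem_univ, if_true, Pi.sub_apply, Pi.single_apply]
  split_ifs <;> simp

variable {G} in
theorem exists_edgeDiff_eq (hconn : G.Connected) (c : Fin N → Fin S → ℝ)
    (hc : ∑ i, c i = 0) : ∃ lam, edgeDiff G lam = c := by
  obtain ⟨r⟩ := hconn.nonempty
  have key : ∀ (a : Fin N) (v : Fin S → ℝ),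
      Pi.single a v - Pi.single r v ∈ LinearMap.range (edgeDiffLin (S := S) G) := by
    intro a v
    obtain ⟨w⟩ := hconn.preconnected a r
    induction w with
    | nil => simp
    | cons h _ ih =>
      have := add_mem (single_sub_single_mem_range_of_adj G h v) ih
      simpa using this
  have hsum : c = ∑ i, (Pi.single i (c i) - Pi.single r (c i)) := by
    rw [sum_sub_distrib, Finset.univ_sum_single]
    have : ∑ i, (Pi.single r (c i) : Fin N → Fin S → ℝ) = 0 := by
      have h := map_sum (AddMonoidHom.single (fun _ : Fin N => Fin S → ℝ) r) c univ
      rw [hc, map_zero] at h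
      exact h.symm
    rw [this, sub_zero]
  have hmem : c ∈ LinearMap.range (edgeDiffLin (S := S) G) := by
    rw [hsum]
    exact sum_mem fun i _ => key i _
  exact hmem

end EdgeDiff

/-! ### Local problems -/

theorem continuous_of_convexOn_univ {f : ℝ → ℝ} (hf : ConvexOn ℝ Set.univ f) : Continuous f :=
  continuousOn_univ.1 (hf.continuousOn isOpen_univ)

theorem sum_mul_le_of_mem_unitSimplex {S : ℕ} {m h : Fin S → ℝ} {c : ℝ} (hm : m ∈ unitSimplex S)
    (hh : ∀ s, h s ≤ c) : ∑ s, m s * h s ≤ c := by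
  calc ∑ s, m s * h s ≤ ∑ s, m s * c :=
        sum_le_sum fun s _ => mul_le_mul_of_nonneg_left (hh s) (hm.1 s)
    _ = c := by rw [← sum_mul, hm.2, one_mul]

theorem abs_sub_le_one_of_mem_unitSimplex {S : ℕ} {m m' : Fin S → ℝ} (hm : m ∈ unitSimplex S)
    (hm' : m' ∈ unitSimplex S) (s : Fin S) : |m s - m' s| ≤ 1 := by
  have h1 : ∀ {m : Fin S → ℝ}, m ∈ unitSimplex S → m s ≤ 1 := fun {m} hm => by
    rw [← hm.2]
    exact single_le_sum (fun s _ => hm.1 s) (mem_univ s)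
  rw [abs_le]
  constructor <;> linarith [h1 hm, h1 hm', hm.1 s, hm'.1 s]

/-- The minimax theorem for a finite maximum of separable convex functions. -/
theorem exists_minimax_point {S : ℕ} (hS : 0 < S) {X : Set (Fin S → ℝ)} (hne : X.Nonempty)
    (hconv : Convex ℝ X) (hcomp : IsCompact X) {h : Fin S → ℝ → ℝ}
    (hh : ∀ s, ConvexOn ℝ Set.univ (h s)) :
    ∃ a ∈ X, ∃ b ∈ unitSimplex S, ∀ x ∈ X, ∀ s, h s (a s) ≤ ∑ s', b s' * h s' (x s') := by
  have hcont := fun s => continuous_of_convexOn_univ (hh s)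
  obtain ⟨a, ha, b, hb, hab⟩ := Sion.exists_isSaddlePointOn (X := X)
    (Y := stdSimplex ℝ (Fin S)) (f := fun x m => ∑ s, m s * h s (x s)) hne hconv hcomp
    (fun m _ => (Continuous.lowerSemicontinuous (by fun_prop)).lowerSemicontinuousOn _)
    (fun m hm => by
      refine ConvexOn.quasiconvexOn ⟨hconv, fun x _ y _ p q hp hq hpq => ?_⟩
      simp only [smul_eq_mul, mul_sum, ← sum_add_distrib]
      refine sum_le_sum fun s _ => ?_
      have := mul_le_mul_of_nonneg_left
        ((hh s).2 (Set.mem_univ (x s)) (Set.mem_univ (y s)) hp hq hpq) (hm.1 s)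
      simp only [smul_eq_mul, Pi.add_apply, Pi.smul_apply] at this ⊢
      linarith)
    (convex_stdSimplex ℝ _) ⟨_, single_mem_stdSimplex ℝ (⟨0, hS⟩ : Fin S)⟩
    (isCompact_stdSimplex ℝ _)
    (fun x _ => (Continuous.upperSemicontinuous (by fun_prop)).upperSemicontinuousOn _)
    (fun x _ => by
      refine ConcaveOn.quasiconcaveOn ⟨convex_stdSimplex ℝ _, fun m _ m' _ p q _ _ _ => ?_⟩
      simp only [smul_eq_mul, mul_sum, ← sum_add_distrib, Pi.add_apply, Pi.smul_apply]
      exact (sum_congr rfl fun s _ => by ring).le)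
  refine ⟨a, ha, b, hb, fun x hx s => ?_⟩
  have := hab x hx (Pi.single s 1) (single_mem_stdSimplex ℝ s)
  simpa [Pi.single_apply] using this

section Local

variable {N S : ℕ} {X : Fin N → Set (Fin S → ℝ)} {g : Fin N → Fin S → ℝ → ℝ} {i : Fin N}

theorem dualFn_le (hcomp : IsCompact (X i)) (hg : ∀ s, ConvexOn ℝ Set.univ (g i s))
    {x : Fin S → ℝ} (hx : x ∈ X i) (m : Fin S → ℝ) :
    dualFn X g i m ≤ ∑ s, m s * g i s (x s) := by
  have hcont := fun s => continuous_of_convexOn_univ (hg s)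
  exact csInf_le (hcomp.image (by fun_prop)).bddBelow ⟨x, hx, rfl⟩

/-- Strong duality for the local problem of agent `i`, together with attainment of the primal
value. -/
theorem local_strong_duality (hS : 0 < S) (hne : (X i).Nonempty) (hconv : Convex ℝ (X i))
    (hcomp : IsCompact (X i)) (hg : ∀ s, ConvexOn ℝ Set.univ (g i s)) {d m : Fin S → ℝ}
    (hm : m ∈ unitSimplex S)
    (hmax : ∀ ν ∈ unitSimplex S,
      dualFn X g i ν + ∑ s, ν s * d s ≤ dualFn X g i m + ∑ s, m s * d s) :
    sInf ((fun x : Fin S → ℝ => ⨆ s : Fin S, (g i s (x s) + d s)) '' X i) =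
        dualFn X g i m + ∑ s, m s * d s ∧
      ∃ a ∈ X i, ∀ s, g i s (a s) + d s ≤ dualFn X g i m + ∑ s, m s * d s := by
  have : Nonempty (Fin S) := ⟨⟨0, hS⟩⟩
  obtain ⟨a, ha, b, hb, hab⟩ := exists_minimax_point hS hne hconv hcomp
    (h := fun s y => g i s y + d s) fun s => (hg s).add_const _
  have hup : ∀ s, g i s (a s) + d s ≤ dualFn X g i m + ∑ s, m s * d s := fun s => by
    refine le_trans ?_ (hmax b hb)
    rw [← sub_le_iff_le_add]
    refine le_csInf (hne.image _) ?_
    rintro _ ⟨x, hx, rfl⟩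
    have := hab x hx s
    simp only [mul_add, sum_add_distrib] at this
    simp only
    linarith
  have hlow : ∀ x ∈ X i,
      dualFn X g i m + ∑ s, m s * d s ≤ ⨆ s : Fin S, (g i s (x s) + d s) := fun x hx => by
    refine le_trans ?_ (sum_mul_le_of_mem_unitSimplex hm fun s =>
      le_ciSup (f := fun s => g i s (x s) + d s) (Set.finite_range _).bddAbove s)
    simp only [mul_add, sum_add_distrib]
    linarith [dualFn_le hcomp hg hx m]
  refine ⟨le_antisymm ?_ ?_, a, ha, hup⟩
  · refine (csInf_le ⟨dualFn X g i m + ∑ s, m s * d s, ?_⟩ (Set.mem_image_of_mem _ ha)).trans (ciSup_le hup)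
    rintro _ ⟨x, hx, rfl⟩
    exact hlow x hx
  · refine le_csInf (hne.image _) ?_
    rintro _ ⟨x, hx, rfl⟩
    exact hlow x hx

end Local

/-! ### The centralised problem -/

section Primal

variable {N S : ℕ} {X : Fin N → Set (Fin S → ℝ)} {g : Fin N → Fin S → ℝ → ℝ}

/-- The min-max problem attains its optimal value. -/
theorem exists_primal_optimum (hS : 0 < S) (hne : ∀ i, (X i).Nonempty)
    (hcomp : ∀ i, IsCompact (X i)) (hg : ∀ i s, ConvexOn ℝ Set.univ (g i s)) :
    ∃ x : Fin N → Fin S → ℝ, (∀ i, x i ∈ X i) ∧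
      (∀ s, ∑ i, g i s (x i s) ≤ sInf (primalSet X g)) ∧
      ∀ y : Fin N → Fin S → ℝ, (∀ i, y i ∈ X i) → ∀ c, (∀ s, ∑ i, g i s (y i s) ≤ c) →
        sInf (primalSet X g) ≤ c := by
  have : Nonempty (Fin S) := ⟨⟨0, hS⟩⟩
  have hcont := fun i s => continuous_of_convexOn_univ (hg i s)
  have hF : Continuous fun x : Fin N → Fin S → ℝ =>
      univ.sup' univ_nonempty fun s : Fin S => ∑ i, g i s (x i s) :=
    Continuous.finset_sup'_apply _ fun s _ => by fun_prop
  have hsup : ∀ x : Fin N → Fin S → ℝ,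
      univ.sup' univ_nonempty (fun s : Fin S => ∑ i, g i s (x i s)) =
        ⨆ s : Fin S, ∑ i, g i s (x i s) := fun x => sup'_univ_eq_ciSup _
  simp only [hsup] at hF
  obtain ⟨x, hx, hmin⟩ := (isCompact_univ_pi hcomp).exists_isMinOn
    (Set.univ_pi_nonempty_iff.2 hne) hF.continuousOn
  have hx' : ∀ i, x i ∈ X i := fun i => hx i trivial
  have hleast : IsLeast (primalSet X g) (⨆ s : Fin S, ∑ i, g i s (x i s)) := by
    refine ⟨⟨x, hx', rfl⟩, ?_⟩
    rintro _ ⟨y, hy, rfl⟩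
    exact hmin fun i _ => hy i
  rw [hleast.csInf_eq]
  exact ⟨x, hx', fun s => le_ciSup (f := fun s => ∑ i, g i s (x i s))
    (Set.finite_range _).bddAbove s,
    fun y hy c hc => (hleast.2 ⟨y, hy, rfl⟩).trans (ciSup_le hc)⟩

/-- Some edge multiplier bounds the dual objective by the primal optimal value. -/
theorem exists_optimal_multiplier (hN : 0 < N) (hS : 0 < S) (hne : ∀ i, (X i).Nonempty)
    (hcomp : ∀ i, IsCompact (X i)) (hg : ∀ i s, ConvexOn ℝ Set.univ (g i s))
    {G : SimpleGraph (Fin N)} [DecidableRel G.Adj] (hconn : G.Connected) :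
    ∃ lam : Fin N → Fin N → Fin S → ℝ, ∀ m : Fin N → Fin S → ℝ, (∀ i, m i ∈ unitSimplex S) →
      ∑ i, (dualFn X g i (m i) + ∑ s, m i s * edgeDiff G lam i s) ≤ sInf (primalSet X g) := by
  have hN' : (N : ℝ) ≠ 0 := by positivity
  obtain ⟨x, hx, hxle, -⟩ := exists_primal_optimum hS hne hcomp hg
  obtain ⟨lam, hlam⟩ := exists_edgeDiff_eq hconn
    (fun i s => (∑ j, g j s (x j s)) / N - g i s (x i s)) (by
      ext s
      simp [Finset.sum_apply, mul_div_cancel₀ _ hN'])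
  refine ⟨lam, fun m hm => ?_⟩
  have hi : ∀ i, dualFn X g i (m i) + ∑ s, m i s * edgeDiff G lam i s ≤
      sInf (primalSet X g) / N := fun i => by
    refine le_trans (add_le_add_left (dualFn_le (hcomp i) (hg i) (hx i) (m i)) _) ?_
    rw [← sum_add_distrib, hlam]
    simp only [← mul_add, add_sub_cancel]
    exact sum_mul_le_of_mem_unitSimplex (hm i) fun s =>
      div_le_div_of_nonneg_right (hxle s) N.cast_nonneg
  refine (sum_le_sum fun i _ => hi i).trans_eq ?_
  simp [mul_div_cancel₀ _ hN']

end Primal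

/-- Convergence in cost of the distributed min-max algorithm (Theorem 1, part 1):
`Σ_i ρ^i(t) → P*`. -/
theorem distributed_minmax_cost_convergence (N S : ℕ) (hN : 0 < N) (hS : 0 < S)
    (X : Fin N → Set (Fin S → ℝ))
    (hXne : ∀ i, (X i).Nonempty)
    (hXconv : ∀ i, Convex ℝ (X i))
    (hXcomp : ∀ i, IsCompact (X i))
    (g : Fin N → Fin S → ℝ → ℝ)
    (hg : ∀ i s, ConvexOn ℝ Set.univ (g i s))
    (G : SimpleGraph (Fin N)) [DecidableRel G.Adj]
    (hconn : G.Connected)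
    (γ : ℕ → ℝ)
    (hγnonneg : ∀ t, 0 ≤ γ t)
    (hγto0 : Tendsto γ atTop (𝓝 0))
    (hγdiv : Tendsto (fun n => ∑ t ∈ Finset.range n, γ t) atTop atTop)
    (hγsq : Summable (fun t => γ t ^ 2))
    (hmin : ∃ lamstar : Fin N → Fin N → Fin S → ℝ,
      ∀ lam, etaFn X g G lamstar ≤ etaFn X g G lam)
    (lam : ℕ → Fin N → Fin N → Fin S → ℝ)
    (μ : ℕ → Fin N → Fin S → ℝ)
    (ρ : ℕ → Fin N → ℝ)
    (hmax : ∀ t i, μ (t + 1) i ∈ unitSimplex S ∧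
      ∀ ν ∈ unitSimplex S,
        dualFn X g i ν + ∑ s, ν s * edgeDiff G (lam t) i s ≤
        dualFn X g i (μ (t + 1) i) + ∑ s, μ (t + 1) i s * edgeDiff G (lam t) i s)
    (hρ : ∀ t i, ρ (t + 1) i =
      sInf ((fun x : Fin S → ℝ =>
        ⨆ s : Fin S, (g i s (x s) + edgeDiff G (lam t) i s)) '' X i))
    (hupd : ∀ t i j, G.Adj i j →
      lam (t + 1) i j = lam t i j - γ t • (μ (t + 1) i - μ (t + 1) j)) :
    Tendsto (fun t => ∑ i, ρ t i) atTop (𝓝 (sInf (primalSet X g))) := by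
  obtain ⟨L, hL⟩ := exists_optimal_multiplier hN hS hXne hXcomp hg hconn
  obtain ⟨-, -, -, hPle⟩ := exists_primal_optimum hS hXne hXcomp hg
  set P := sInf (primalSet X g)
  have hloc := fun t i => local_strong_duality hS (hXne i) (hXconv i) (hXcomp i) (hg i)
    (hmax t i).1 (hmax t i).2
  have hm := fun t i => (hmax t i).1
  set K : ℝ := ∑ _i : Fin N, ∑ _j : Fin N, ∑ _s : Fin S, 1
  have hK : ∀ f : Fin N → Fin N → Fin S → ℝ, (∀ i j s, f i j s ≤ 1) →
      (∑ i, ∑ j, if G.Adj i j then ∑ s, f i j s else 0) ≤ K := fun f hf => by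
    refine sum_le_sum fun i _ => sum_le_sum fun j _ => ?_
    split_ifs
    · exact sum_le_sum fun s _ => hf i j s
    · positivity
  have hprod : ∀ t t' i j s,
      -((μ (t + 1) i s - μ (t + 1) j s) * (μ (t' + 1) i s - μ (t' + 1) j s)) ≤ 1 ∧
      (μ (t + 1) i s - μ (t + 1) j s) * (μ (t' + 1) i s - μ (t' + 1) j s) ≤ 1 := by
    intro t t' i j s
    have h := mul_le_one₀ (abs_sub_le_one_of_mem_unitSimplex (hm t i) (hm t j) s) (abs_nonneg _)
      (abs_sub_le_one_of_mem_unitSimplex (hm t' i) (hm t' j) s)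
    rw [← abs_mul, abs_le] at h
    constructor <;> linarith [h.1, h.2]
  set a : ℕ → ℝ := fun t => ∑ i, ρ (t + 1) i - P with ha
  have hρsum : ∀ t, ∑ i, ρ (t + 1) i =
      ∑ i, dualFn X g i (μ (t + 1) i) + ∑ i, ∑ s, μ (t + 1) i s * edgeDiff G (lam t) i s := by
    intro t
    rw [← sum_add_distrib]
    exact sum_congr rfl fun i _ => (hρ t i).trans (hloc t i).1
  have ha0 : ∀ t, 0 ≤ a t := fun t => by
    choose y hy hys using fun i => (hloc t i).2
    refine sub_nonneg.2 (hPle y hy _ fun s => ?_)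
    have h1 := sum_le_sum fun i (_ : i ∈ univ) => hys i s
    rw [sum_add_distrib, sum_edgeDiff, add_zero, sum_add_distrib] at h1
    rwa [hρsum]
  have hsub : ∀ t, a t ≤ ∑ i, ∑ j, if G.Adj i j then
      ∑ s, (μ (t + 1) i s - μ (t + 1) j s) * (lam t i j s - L i j s) else 0 := fun t => by
    rw [← sum_mul_edgeDiff_sub]
    have := hL _ (hm t)
    rw [sum_add_distrib] at this
    simp only [ha, hρsum]
    linarith
  have hinc : ∀ t, a (t + 1) ≤ a t + K * γ t := fun t => by
    have h1 := sum_le_sum fun i (_ : i ∈ univ) => (hmax t i).2 _ (hm (t + 1) i)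
    rw [sum_add_distrib, sum_add_distrib, ← hρsum] at h1
    have h2 := sum_mul_edgeDiff_sub G (μ (t + 1 + 1)) (lam (t + 1)) (lam t)
    have h3 : (∑ i, ∑ j, if G.Adj i j then ∑ s, (μ (t + 1 + 1) i s - μ (t + 1 + 1) j s) *
        (lam (t + 1) i j s - lam t i j s) else 0) = γ t * ∑ i, ∑ j, if G.Adj i j then
        ∑ s, -((μ (t + 1 + 1) i s - μ (t + 1 + 1) j s) *
          (μ (t + 1) i s - μ (t + 1) j s)) else 0 := by
      simp only [mul_sum]
      refine sum_congr rfl fun i _ => sum_congr rfl fun j _ => ?_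
      split_ifs with hij
      · rw [mul_sum]
        refine sum_congr rfl fun s _ => ?_
        rw [hupd t i j hij]
        simp only [Pi.sub_apply, Pi.smul_apply, smul_eq_mul]
        ring
      · simp
    have h4 := mul_le_mul_of_nonneg_left (hK _ fun i j s => (hprod (t + 1) t i j s).1)
      (hγnonneg t)
    have h5 := hρsum (t + 1)
    simp only [ha]
    linarith
  set D : ℕ → ℝ := fun t => ∑ i, ∑ j, if G.Adj i j then
    ∑ s, (lam t i j s - L i j s) ^ 2 else 0 with hD
  have hD0 : ∀ t, 0 ≤ D t := fun t =>
    sum_nonneg fun i _ => sum_nonneg fun j _ => by split_ifs <;> positivity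
  have hDstep : ∀ t, D (t + 1) ≤ D t - 2 * (γ t * a t) + K * γ t ^ 2 := fun t => by
    have h1 : D (t + 1) = D t - 2 * γ t * (∑ i, ∑ j, if G.Adj i j then
        ∑ s, (μ (t + 1) i s - μ (t + 1) j s) * (lam t i j s - L i j s) else 0) +
        γ t ^ 2 * ∑ i, ∑ j, if G.Adj i j then
        ∑ s, (μ (t + 1) i s - μ (t + 1) j s) * (μ (t + 1) i s - μ (t + 1) j s) else 0 := by
      simp only [hD, mul_sum, ← sum_sub_distrib, ← sum_add_distrib]
      refine sum_congr rfl fun i _ => sum_congr rfl fun j _ => ?_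
      split_ifs with hij
      · simp only [mul_sum, ← sum_sub_distrib, ← sum_add_distrib]
        refine sum_congr rfl fun s _ => ?_
        rw [hupd t i j hij]
        simp only [Pi.sub_apply, Pi.smul_apply, smul_eq_mul]
        ring
      · simp
    have h2 := mul_le_mul_of_nonneg_left (hsub t) (hγnonneg t)
    have h3 := mul_le_mul_of_nonneg_left (hK _ fun i j s => (hprod t t i j s).2)
      (sq_nonneg (γ t))
    linarith
  have hγa : Summable fun t => γ t * a t := by
    refine summable_of_sum_range_le (c := D 0 + K * ∑' t, γ t ^ 2)
      (fun t => mul_nonneg (hγnonneg t) (ha0 t)) fun n => ?_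
    have h1 : ∀ n, D n + 2 * ∑ t ∈ range n, γ t * a t ≤
        D 0 + K * ∑ t ∈ range n, γ t ^ 2 := fun n => by
      induction n with
      | zero => simp
      | succ n ih =>
        rw [sum_range_succ, sum_range_succ]
        linarith [hDstep n]
    have h2 : 0 ≤ ∑ t ∈ range n, γ t * a t :=
      sum_nonneg fun t _ => mul_nonneg (hγnonneg t) (ha0 t)
    have h3 := mul_le_mul_of_nonneg_left
      (hγsq.sum_le_tsum (range n) fun t _ => sq_nonneg (γ t)) (show 0 ≤ K by positivity)
    linarith [h1 n, hD0 n]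
  have hlim := tendsto_zero_of_summable_mul hγnonneg hγdiv hγsq ha0 hγa hinc
  rw [← tendsto_add_atTop_iff_nat 1]
  simpa [ha] using hlim.add_const P

end
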